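/- Let (Ω_j, 𝓕_j, P_j), j = 1, …, m, be probability spaces and let B_1, …, B_d be measurable subsets of the product ∏_{j=1}^m Ω_j (with the product σ-algebra) that are pairwise disjoint and whose union is the whole product space. Then there exist probability measures Q_1, …, Q_m, where each Q_j is finitely supported on Ω_j with at most d atoms, such that (⨂_{j=1}^m Q_j)(B_k) = (⨂_{j=1}^m P_j)(B_k) for every k = 1, …, d. (This is Lemma ctf_cp3 of the paper: any joint distribution over a finite measurable partition of a product of probability spaces can be reproduced by a product of finitely supported measures, each with at most d states where d is the number of partition cells.) -/

import Mathlib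

open MeasureTheory
open scoped ENNReal

/-- A measure `Q` is *finitely supported with at most `d` atoms* if it is a convex
combination of at most `d` Dirac measures. -/
def FinitelySupportedWith {Ω : Type*} [MeasurableSpace Ω] (Q : Measure Ω) (d : ℕ) : Prop :=
  ∃ (u : Fin d → Ω) (w : Fin d → ℝ≥0∞),
    (∑ k, w k = 1) ∧ Q = ∑ k, w k • Measure.dirac (u k)

/-- A nonzero linear functional is nonzero at some point of any spanning set. -/
theorem exists_mem_ne_zero_of_span_eq_top {E : Type*} [AddCommGroup E] [Module ℝ E]
    {C : Set E} (hspan : Submodule.span ℝ C = ⊤) {f : E →ₗ[ℝ] ℝ} (hf : f ≠ 0) :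
    ∃ x ∈ C, f x ≠ 0 := by
  by_contra! h
  exact hf (LinearMap.ext_on hspan fun x hx => by simpa using h x hx)

/-- Proper separation of the origin from a convex set spanning a finite-dimensional space. -/
theorem Convex.exists_nonneg_of_span_eq_top {E : Type*} [NormedAddCommGroup E] [NormedSpace ℝ E]
    [FiniteDimensional ℝ E] {C : Set E} (hC : Convex ℝ C) (hne : C.Nonempty)
    (h0 : (0 : E) ∉ C) (hspan : Submodule.span ℝ C = ⊤) :
    ∃ f : E →ₗ[ℝ] ℝ, (∀ x ∈ C, 0 ≤ f x) ∧ ∃ x ∈ C, f x ≠ 0 := by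
  by_cases hint : (interior C).Nonempty
  · obtain ⟨f, hf, hle⟩ :=
      geometric_hahn_banach_of_nonempty_interior_point hC (fun h => h0 (interior_subset h)) hint
    have hf' : -(f : E →ₗ[ℝ] ℝ) ≠ 0 :=
      neg_ne_zero.2 fun h => hf (ContinuousLinearMap.coe_injective h)
    exact ⟨_, fun x hx => by simpa using hle x hx, exists_mem_ne_zero_of_span_eq_top hspan hf'⟩
  · rw [hC.interior_nonempty_iff_affineSpan_eq_top] at hint
    have hD : vectorSpan ℝ C < ⊤ := by
      refine lt_top_iff_ne_top.2 fun h => hint ?_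
      exact (AffineSubspace.affineSpan_eq_top_iff_vectorSpan_eq_top_of_nonempty ℝ E E hne).2 h
    obtain ⟨f, hf, hker⟩ := Submodule.exists_le_ker_of_lt_top _ hD
    obtain ⟨x₀, hx₀, hfx₀⟩ := exists_mem_ne_zero_of_span_eq_top hspan hf
    have hconst : ∀ x ∈ C, f x = f x₀ := by
      intro x hx
      have := hker (vsub_mem_vectorSpan ℝ hx hx₀)
      simpa [sub_eq_zero] using this
    rcases hfx₀.lt_or_gt with h | h
    · exact ⟨-f, fun x hx => by simpa [hconst x hx] using h.le, x₀, hx₀, by simpa using hfx₀⟩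
    · exact ⟨f, fun x hx => by simpa [hconst x hx] using h.le, x₀, hx₀, hfx₀⟩

/-- Proper separation of the origin from a convex set in a finite-dimensional space. -/
theorem Convex.exists_nonneg_of_zero_notMem {E : Type*} [NormedAddCommGroup E] [NormedSpace ℝ E]
    [FiniteDimensional ℝ E] {C : Set E} (hC : Convex ℝ C) (hne : C.Nonempty)
    (h0 : (0 : E) ∉ C) :
    ∃ f : E →ₗ[ℝ] ℝ, (∀ x ∈ C, 0 ≤ f x) ∧ ∃ x ∈ C, f x ≠ 0 := by
  let V := Submodule.span ℝ C
  have hmem : ∀ x ∈ C, x ∈ V := fun x hx => Submodule.subset_span hx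
  obtain ⟨y, hy⟩ := hne
  obtain ⟨g, hg, ⟨x, hx, hgx⟩⟩ :=
    (hC.linear_preimage V.subtype).exists_nonneg_of_span_eq_top
      ⟨⟨y, hmem y hy⟩, hy⟩ (by simpa using h0) (Submodule.span_span_coe_preimage)
  obtain ⟨f, hf⟩ := g.exists_extend
  have hfg : ∀ z : V, f z = g z := fun z => by rw [← hf]; rfl
  exact ⟨f, fun z hz => by simpa [hfg ⟨z, hmem z hz⟩] using hg ⟨z, hmem z hz⟩ hz,
    x, hx, by rwa [hfg]⟩

/-- In finite dimension, the mean of a random vector lying almost surely in a convex set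
(not necessarily closed) belongs to that set. -/
theorem Convex.integral_mem_of_finiteDimensional {Ω E : Type*} [MeasurableSpace Ω]
    {μ : Measure Ω} [IsProbabilityMeasure μ] [NormedAddCommGroup E] [NormedSpace ℝ E]
    [FiniteDimensional ℝ E] {C : Set E} (hC : Convex ℝ C) {X : Ω → E} (hX : Integrable X μ)
    (hXC : ∀ᵐ ω ∂μ, X ω ∈ C) : ∫ ω, X ω ∂μ ∈ C := by
  have : CompleteSpace E := FiniteDimensional.complete ℝ E
  have key : ∀ (n : ℕ) (C : Set E), Module.finrank ℝ (Submodule.span ℝ C) = n → Convex ℝ C →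
      ∀ Y : Ω → E, Integrable Y μ → (∀ᵐ ω ∂μ, Y ω ∈ C) → ∫ ω, Y ω ∂μ = 0 → (0 : E) ∈ C := by
    intro n
    induction n using Nat.strong_induction_on with
    | _ n ih =>
      intro C hn hC Y hY hYC hmean
      by_contra h0
      obtain ⟨ω, hω⟩ := hYC.exists
      obtain ⟨f, hf, x, hx, hfx⟩ := hC.exists_nonneg_of_zero_notMem ⟨_, hω⟩ h0
      let F : E →L[ℝ] ℝ := f.toContinuousLinearMap
      have hFY : ∫ ω, F (Y ω) ∂μ = 0 := by
        rw [F.integral_comp_comm hY, hmean, map_zero]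
      have hzero : ∀ᵐ ω ∂μ, F (Y ω) = 0 :=
        (integral_eq_zero_iff_of_nonneg_ae (hYC.mono fun ω h => hf _ h)
          (F.integrable_comp hY)).1 hFY
      have hlt : Submodule.span ℝ (C ∩ {y | f y = 0}) < Submodule.span ℝ C := by
        refine lt_of_le_of_ne (Submodule.span_mono Set.inter_subset_left) fun h => hfx ?_
        have hle : Submodule.span ℝ (C ∩ {y | f y = 0}) ≤ LinearMap.ker f :=
          Submodule.span_le.2 fun y hy => hy.2
        exact hle (h ▸ Submodule.subset_span hx)
      refine h0 (ih _ (hn ▸ Submodule.finrank_lt_finrank_of_lt hlt) _ rfl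
        (hC.inter (LinearMap.ker f).convex) Y hY ?_ hmean).1
      filter_upwards [hYC, hzero] with ω h₁ h₂ using ⟨h₁, h₂⟩
  have h := key _ ((fun y => y + ∫ ω, X ω ∂μ) ⁻¹' C) rfl (hC.translate_preimage_left _)
    (fun ω => X ω - ∫ ω, X ω ∂μ) (hX.sub (integrable_const _))
    (hXC.mono fun ω h => by simpa using h) (by
      rw [integral_sub hX (integrable_const _)]; simp)
  simpa using h

/-- A probability measure can be replaced by a finitely supported one with at most `d` atoms
without changing the integrals of `d` nonnegative functions summing to one. -/
theorem exists_finitelySupportedWith_lintegral_eq {Ω : Type*} [MeasurableSpace Ω]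
    (μ : Measure Ω) [IsProbabilityMeasure μ] {d : ℕ} (g : Fin d → Ω → ℝ≥0∞)
    (hg : ∀ k, Measurable (g k)) (hsum : ∀ x, ∑ k, g k x = 1) :
    ∃ ν : Measure Ω, IsProbabilityMeasure ν ∧ FinitelySupportedWith ν d ∧
      ∀ k, ∫⁻ x, g k x ∂ν = ∫⁻ x, g k x ∂μ := by
  have hle : ∀ k x, g k x ≤ 1 := fun k x =>
    (Finset.single_le_sum (f := fun k => g k x) (fun _ _ => zero_le) (Finset.mem_univ k)).trans_eq
      (hsum x)
  have hfin : ∀ k x, g k x ≠ ∞ := fun k x => ((hle k x).trans_lt ENNReal.one_lt_top).ne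
  let X : Ω → Fin d → ℝ := fun x k => (g k x).toReal
  have hXk : ∀ k, Integrable (fun x => X x k) μ := fun k =>
    integrable_toReal_of_lintegral_ne_top (hg k).aemeasurable
      (((lintegral_mono (hle k)).trans_lt (by simp)).ne)
  have hX : Integrable X μ := Integrable.of_eval hXk
  have hXsum : ∀ x, ∑ k, X x k = 1 := fun x => by
    rw [← ENNReal.toReal_sum fun k _ => hfin k x, hsum x, ENNReal.toReal_one]
  have hmean := (convex_convexHull ℝ (Set.range X)).integral_mem_of_finiteDimensional hX
    (Filter.Eventually.of_forall fun x => subset_convexHull ℝ _ ⟨x, rfl⟩)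
  obtain ⟨ι, _, z, w, hz, haff, hw, hw1, hwz⟩ := eq_pos_convex_span_of_mem_convexHull hmean
  choose v hv using fun i => hz ⟨i, rfl⟩
  have hzsum : ∀ i, ∑ k, z i k = 1 := fun i => by rw [← hv i, hXsum]
  have hlin : LinearIndependent ℝ z := by
    rw [Fintype.linearIndependent_iff]
    intro c hc
    have hc0 : ∑ i, c i = 0 := by
      have := congrArg (fun y : Fin d → ℝ => ∑ k, y k) hc
      simp only [Finset.sum_apply, Pi.smul_apply, smul_eq_mul, Pi.zero_apply,
        Finset.sum_const_zero] at this
      rw [Finset.sum_comm] at this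
      simpa [← Finset.mul_sum, hzsum] using this
    intro i
    exact (affineIndependent_iff.1 haff) Finset.univ c hc0 hc i (Finset.mem_univ i)
  have hcard : Fintype.card ι ≤ d := by simpa using hlin.fintype_card_le_finrank
  obtain ⟨x₀⟩ : Nonempty Ω := μ.nonempty_of_neZero
  obtain ⟨e⟩ : Nonempty (ι ↪ Fin d) :=
    Function.Embedding.nonempty_of_card_le (by simpa using hcard)
  have hext : ∀ F : Fin d → ℝ≥0∞, (∀ k ∉ Set.range e, F k = 0) → ∑ k, F k = ∑ i, F (e i) :=
    fun F hF => (Fintype.sum_of_injective e e.injective (fun i => F (e i)) F hF fun _ => rfl).symm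
  let u : Fin d → Ω := Function.extend e v fun _ => x₀
  let W : Fin d → ℝ≥0∞ := Function.extend e (fun i => ENNReal.ofReal (w i)) 0
  have hue : ∀ i, u (e i) = v i := fun i => e.injective.extend_apply _ _ i
  have hWe : ∀ i, W (e i) = ENNReal.ofReal (w i) := fun i => e.injective.extend_apply _ _ i
  have hW0 : ∀ k ∉ Set.range e, W k = 0 := fun k hk =>
    Function.extend_apply' _ _ _ hk
  have hW1 : ∑ k, W k = 1 := by
    rw [hext W hW0]
    simp only [hWe]
    rw [← ENNReal.ofReal_sum_of_nonneg fun i _ => (hw i).le, hw1, ENNReal.ofReal_one]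
  refine ⟨∑ k, W k • Measure.dirac (u k), ⟨by simp [hW1]⟩, ⟨u, W, hW1, rfl⟩, fun k => ?_⟩
  rw [lintegral_finsetSum_measure]
  simp only [lintegral_smul_measure, lintegral_dirac' _ (hg k), smul_eq_mul]
  rw [hext _ fun j hj => by simp [hW0 j hj]]
  simp only [hWe, hue]
  have hk := congrFun hwz k
  rw [Finset.sum_apply, eval_integral hXk] at hk
  have hμ : ∫⁻ x, g k x ∂μ = ENNReal.ofReal (∫ x, X x k ∂μ) := by
    rw [ofReal_integral_eq_lintegral_ofReal (hXk k)
      (Filter.Eventually.of_forall fun x => ENNReal.toReal_nonneg)]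
    exact lintegral_congr fun x => (ENNReal.ofReal_toReal (hfin k x)).symm
  rw [hμ, ← hk, ENNReal.ofReal_sum_of_nonneg]
  · refine Finset.sum_congr rfl fun i _ => ?_
    rw [Pi.smul_apply, smul_eq_mul, ENNReal.ofReal_mul (hw i).le, ← hv i,
      ENNReal.ofReal_toReal (hfin _ _)]
  · intro i _
    rw [Pi.smul_apply, smul_eq_mul, ← hv i]
    exact mul_nonneg (hw i).le ENNReal.toReal_nonneg

/-- Changing one factor of a finite product measure amounts to resampling that coordinate. -/
theorem pi_update_eq_map_prod {ι : Type*} [Fintype ι] [DecidableEq ι] {Ω : ι → Type*}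
    [∀ j, MeasurableSpace (Ω j)] (Q : ∀ j, Measure (Ω j)) [∀ j, IsProbabilityMeasure (Q j)]
    (j : ι) (ν : Measure (Ω j)) [IsProbabilityMeasure ν] :
    Measure.pi (Function.update Q j ν) =
      ((Measure.pi Q).prod ν).map fun p => Function.update p.1 j p.2 := by
  have hprob : ∀ i, IsProbabilityMeasure (Function.update Q j ν i) := by
    intro i
    rcases eq_or_ne i j with rfl | h
    · simpa
    · simpa [h] using inferInstanceAs (IsProbabilityMeasure (Q i))
  have hmeas : Measurable fun p : (∀ i, Ω i) × Ω j => Function.update p.1 j p.2 :=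
    measurable_update'
  refine Measure.pi_eq fun s hs => ?_
  rw [Measure.map_apply hmeas (MeasurableSet.univ_pi hs)]
  have hpre : (fun p : (∀ i, Ω i) × Ω j => Function.update p.1 j p.2) ⁻¹' Set.univ.pi s =
      (Set.univ.pi (Function.update s j Set.univ)) ×ˢ s j := by
    ext p
    simp only [Set.mem_preimage, Set.mem_univ_pi, Set.mem_prod]
    constructor
    · intro h
      refine ⟨fun i => ?_, by simpa using h j⟩
      rcases eq_or_ne i j with rfl | hi
      · simp
      · simpa [hi] using h i
    · rintro ⟨h₁, h₂⟩ i
      rcases eq_or_ne i j with rfl | hi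
      · simpa
      · simpa [hi] using h₁ i
  rw [hpre, Measure.prod_prod, Measure.pi_pi, ← Finset.mul_prod_erase _ _ (Finset.mem_univ j),
    ← Finset.mul_prod_erase _ (fun i => Function.update Q j ν i (s i)) (Finset.mem_univ j)]
  simp only [Function.update_self, measure_univ, one_mul]
  rw [mul_comm]
  congr 1
  refine Finset.prod_congr rfl fun i hi => ?_
  simp [Finset.ne_of_mem_erase hi]

/-- **Lemma ctf_cp3.**  Given probability spaces `(Ω j, P j)`, `j = 1, …, m`,
and a finite measurable partition `B 1, …, B d` of the product `∀ j, Ω j`, there exist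
finitely supported probability measures `Q j` with at most `d` atoms each, whose product
assigns the same probability to every partition cell as the product of the `P j`. -/
theorem product_partition_discretization
    {m d : ℕ} {Ω : Fin m → Type*} [∀ j, MeasurableSpace (Ω j)]
    (P : ∀ j, Measure (Ω j)) [∀ j, IsProbabilityMeasure (P j)]
    (B : Fin d → Set (∀ j, Ω j))
    (hBmeas : ∀ k, MeasurableSet (B k))
    (hBdisj : Pairwise (Function.onFun Disjoint B))
    (hBunion : (⋃ k, B k) = Set.univ) :
    ∃ Q : ∀ j, Measure (Ω j),
      (∀ j, IsProbabilityMeasure (Q j)) ∧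
      (∀ j, FinitelySupportedWith (Q j) d) ∧
      ∀ k, Measure.pi Q (B k) = Measure.pi P (B k) := by
  suffices h : ∀ s : Finset (Fin m), ∃ Q : ∀ j, Measure (Ω j),
      (∀ j, IsProbabilityMeasure (Q j)) ∧ (∀ j ∈ s, FinitelySupportedWith (Q j) d) ∧
      ∀ k, Measure.pi Q (B k) = Measure.pi P (B k) by
    simpa using h Finset.univ
  intro s
  induction s using Finset.induction_on with
  | empty => exact ⟨P, inferInstance, by simp, fun _ => rfl⟩
  | insert j s hj ih =>
    obtain ⟨Q, hQ, hQs, hQB⟩ := ih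
    let U : (∀ i, Ω i) × Ω j → ∀ i, Ω i := fun p => Function.update p.1 j p.2
    have hU : Measurable U := measurable_update'
    let g : Fin d → Ω j → ℝ≥0∞ := fun k x => Measure.pi Q ((fun ω => (ω, x)) ⁻¹' (U ⁻¹' B k))
    have hg : ∀ k, Measurable (g k) := fun k => measurable_measure_prodMk_right (hU (hBmeas k))
    have hint : ∀ (ν : Measure (Ω j)) [IsProbabilityMeasure ν] (k : Fin d),
        Measure.pi (Function.update Q j ν) (B k) = ∫⁻ x, g k x ∂ν := by
      intro ν _ k
      rw [pi_update_eq_map_prod, Measure.map_apply hU (hBmeas k),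
        Measure.prod_apply_symm (hU (hBmeas k))]
    have hsum : ∀ x, ∑ k, g k x = 1 := by
      intro x
      have hx : Measurable fun ω : ∀ i, Ω i => U (ω, x) := hU.comp measurable_prodMk_right
      rw [← measure_univ (μ := Measure.pi Q), ← Set.preimage_univ (f := fun ω => U (ω, x)),
        ← hBunion, Set.preimage_iUnion, measure_iUnion
          (fun a b hab => (hBdisj hab).preimage _) fun k => hx (hBmeas k), tsum_fintype]
      rfl
    obtain ⟨ν, hν, hνd, hνint⟩ := exists_finitelySupportedWith_lintegral_eq (Q j) g hg hsum
    refine ⟨Function.update Q j ν, fun i => ?_, fun i hi => ?_, fun k => ?_⟩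
    · rcases eq_or_ne i j with rfl | h
      · simpa
      · simpa [h] using hQ i
    · rcases eq_or_ne i j with rfl | h
      · simpa
      · simpa [h] using hQs i (Finset.mem_of_mem_insert_of_ne hi h)
    · rw [hint ν, hνint, ← hint (Q j), Function.update_eq_self, hQB]
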